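/- arXiv:math/0101229 — 4 statements merged into one kernel-verified Lean document; each statement's English description precedes it below -/
import Mathlib

section
/- Let q ∈ ℝ and m, n ∈ ℤ with q ≠ 0, q^{2m} ≠ 1 and q^{2n} ≠ 1, and let g : ℝ × ℝ → ℝ be a function such that for every (x,p) the series Σ_{k=0}^∞ q^{2(m+n)k} g(q^{2mk} x, q^{2nk} p) converges. Define G(x,p) = −(q^{2m} − 1)(q^{2n} − 1) · x p · Σ_{k=0}^∞ q^{2(m+n)k} g(q^{2mk} x, q^{2nk} p). Then for every x ≠ 0 and p ≠ 0 one has (G(q^{2m} x, q^{2n} p) − G(x,p))/((q^{2m} − 1) x (q^{2n} − 1) p) = g(x,p); that is, G = ∇̂_{mn}^{-1} g, so the two-variable q-difference operator ∇̂_{mn} is inverted by an extended Jackson-type integral (Proposition 3.1). -/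
/-- Proposition 3.1 (first part): the two-variable q-difference operator
`∇̂_{mn} g(x,p) = (g(q^{2m}x, q^{2n}p) - g(x,p))/((q^{2m}-1)x(q^{2n}-1)p)`
is inverted by the extended Jackson-type integral
`G(x,p) = -(q^{2m}-1)(q^{2n}-1) xp Σ_{k=0}^∞ q^{2(m+n)k} g(q^{2mk}x, q^{2nk}p)`. -/
theorem extended_jackson_inverts_nabla_hat
    (q : ℝ) (m n : ℤ) (hq : q ≠ 0)
    (hm : q ^ (2 * m) ≠ 1) (hn : q ^ (2 * n) ≠ 1)
    (g : ℝ × ℝ → ℝ) (S : ℝ × ℝ → ℝ)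
    (hS : ∀ x p : ℝ, Filter.Tendsto
      (fun N : ℕ => ∑ k ∈ Finset.range N,
        q ^ (2 * (m + n) * (k : ℤ)) * g (q ^ (2 * m * (k : ℤ)) * x, q ^ (2 * n * (k : ℤ)) * p))
      Filter.atTop (nhds (S (x, p))))
    (G : ℝ × ℝ → ℝ)
    (hG : ∀ x p : ℝ,
      G (x, p) = -((q ^ (2 * m) - 1) * (q ^ (2 * n) - 1)) * (x * p) * S (x, p)) :
    ∀ x p : ℝ, x ≠ 0 → p ≠ 0 →
      (G (q ^ (2 * m) * x, q ^ (2 * n) * p) - G (x, p)) /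
        ((q ^ (2 * m) - 1) * x * ((q ^ (2 * n) - 1) * p)) = g (x, p) := by
  intro x p hx hp
  have key : S (x, p) = g (x, p)
      + q ^ (2 * m) * q ^ (2 * n) * S (q ^ (2 * m) * x, q ^ (2 * n) * p) := by
    have h1 := (hS x p).comp (Filter.tendsto_add_atTop_nat 1)
    have h2 := ((hS (q ^ (2 * m) * x) (q ^ (2 * n) * p)).const_mul
      (q ^ (2 * m) * q ^ (2 * n))).const_add (g (x, p))
    refine tendsto_nhds_unique h1 (h2.congr fun N => ?_)
    simp only [Function.comp]
    rw [Finset.sum_range_succ', Finset.mul_sum, add_comm]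
    congr 1
    · refine Finset.sum_congr rfl fun k _ => ?_
      have e1 : q ^ (2 * m * ((k + 1 : ℕ) : ℤ)) = q ^ (2 * m * (k : ℤ)) * q ^ (2 * m) := by
        rw [← zpow_add₀ hq]; congr 1; push_cast; ring
      have e2 : q ^ (2 * n * ((k + 1 : ℕ) : ℤ)) = q ^ (2 * n * (k : ℤ)) * q ^ (2 * n) := by
        rw [← zpow_add₀ hq]; congr 1; push_cast; ring
      have e3 : q ^ (2 * (m + n) * ((k + 1 : ℕ) : ℤ))
          = q ^ (2 * m) * q ^ (2 * n) * q ^ (2 * (m + n) * (k : ℤ)) := by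
        rw [← zpow_add₀ hq, ← zpow_add₀ hq]; congr 1; push_cast; ring
      rw [e1, e2, e3]
      simp only [mul_assoc]
    · simp
  have hm' := sub_ne_zero.2 hm
  have hn' := sub_ne_zero.2 hn
  rw [hG, hG, key, div_eq_iff (by positivity)]
  ring
end

section
/- Let q ∈ ℝ and m, n ∈ ℤ with q ≠ 0, q^{2m} ≠ 1 and q^{2n} ≠ 1, and let g : ℝ × ℝ → ℝ be a function such that for every (x,p) the series Σ_{k=0}^∞ q^{(2k+1)(m+n)} g(q^{(2k+1)m} x, q^{(2k+1)n} p) converges. Define G(x,p) = −(q^m − q^{−m})(q^n − q^{−n}) · x p · Σ_{k=0}^∞ q^{(2k+1)(m+n)} g(q^{(2k+1)m} x, q^{(2k+1)n} p). Then for every x ≠ 0 and p ≠ 0 one has (G(q^m x, q^n p) − G(q^{−m} x, q^{−n} p))/((q^m − q^{−m})(q^n − q^{−n}) x p) = g(x,p); that is, G = ∇̌_{mn}^{-1} g, inverting the symmetric two-variable q-difference operator ∇̌_{mn} by an extended Jackson-type integral (second part of Proposition 3.1). -/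
/-- Proposition 3.1 (second part): the symmetric two-variable q-difference
operator `∇̌_{mn}` is inverted by the extended Jackson-type integral
`G(x,p) = -(q^m - q^{-m})(q^n - q^{-n}) xp
   Σ_{k=0}^∞ q^{(2k+1)(m+n)} g(q^{(2k+1)m}x, q^{(2k+1)n}p)`. -/
theorem extended_jackson_inverts_nabla_check
    (q : ℝ) (m n : ℤ) (hq : q ≠ 0)
    (hm : q ^ (2 * m) ≠ 1) (hn : q ^ (2 * n) ≠ 1)
    (g : ℝ × ℝ → ℝ) (S : ℝ × ℝ → ℝ)
    (hS : ∀ x p : ℝ, Filter.Tendsto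
      (fun N : ℕ => ∑ k ∈ Finset.range N,
        q ^ ((2 * (k : ℤ) + 1) * (m + n)) *
          g (q ^ ((2 * (k : ℤ) + 1) * m) * x, q ^ ((2 * (k : ℤ) + 1) * n) * p))
      Filter.atTop (nhds (S (x, p))))
    (G : ℝ × ℝ → ℝ)
    (hG : ∀ x p : ℝ,
      G (x, p) = -((q ^ m - q ^ (-m)) * (q ^ n - q ^ (-n))) * (x * p) * S (x, p)) :
    ∀ x p : ℝ, x ≠ 0 → p ≠ 0 →
      (G (q ^ m * x, q ^ n * p) - G (q ^ (-m) * x, q ^ (-n) * p)) /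
        ((q ^ m - q ^ (-m)) * (q ^ n - q ^ (-n)) * (x * p)) = g (x, p) := by
  intro x p hx hp
  have key : S (q ^ (-m) * x, q ^ (-n) * p) =
      q ^ (2 * (m + n)) * S (q ^ m * x, q ^ n * p) + q ^ (m + n) * g (x, p) := by
    have h1 := (Filter.tendsto_add_atTop_iff_nat 1).2 (hS (q ^ (-m) * x) (q ^ (-n) * p))
    have h2 := ((hS (q ^ m * x) (q ^ n * p)).const_mul (q ^ (2 * (m + n)))).add_const
      (q ^ (m + n) * g (x, p))
    refine tendsto_nhds_unique h1 (h2.congr fun N => ?_)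
    rw [Finset.sum_range_succ', Finset.mul_sum]
    congr 1
    · refine Finset.sum_congr rfl fun k _ => ?_
      simp only [← mul_assoc, ← zpow_add₀ hq]
      push_cast
      ring_nf
    · simp only [← mul_assoc, ← zpow_add₀ hq]
      simp
  have hm' : q ^ m - q ^ (-m) ≠ 0 := by
    intro h
    apply hm
    rw [two_mul, zpow_add₀ hq]
    nth_rewrite 1 [sub_eq_zero.1 h]
    rw [← zpow_add₀ hq]
    simp
  have hn' : q ^ n - q ^ (-n) ≠ 0 := by
    intro h
    apply hn
    rw [two_mul, zpow_add₀ hq]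
    nth_rewrite 1 [sub_eq_zero.1 h]
    rw [← zpow_add₀ hq]
    simp
  rw [div_eq_iff (by positivity), hG, hG, key]
  have e1 : q ^ (2 * (m + n)) = (q ^ m * q ^ n) * (q ^ m * q ^ n) := by
    rw [two_mul, zpow_add₀ hq, zpow_add₀ hq]
  have a : q ^ (-m) * q ^ m = 1 := by rw [← zpow_add₀ hq]; simp
  have b : q ^ (-n) * q ^ n = 1 := by rw [← zpow_add₀ hq]; simp
  rw [e1, zpow_add₀ hq]
  generalize q ^ (-m) = A at *
  generalize q ^ (-n) = B at *
  generalize q ^ m = C at *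
  generalize q ^ n = D at *
  generalize S (C * x, D * p) = T
  have ab : (A * C) * (B * D) = 1 := by rw [a, b, one_mul]
  linear_combination ((C - A) * (D - B) * x * p * (C * D * T + g (x, p))) * ab
end

section
/- Let K be a field, let q ∈ K be nonzero, and let a, b : ℕ × ℕ → K be finitely supported coefficient families defining the polynomial functions f(x,p) = Σ_{(k,ℓ)} a_{kℓ} x^k p^ℓ and g(x,p) = Σ_{(γ,β)} b_{γβ} x^γ p^β. Then for all x, p ∈ K the q-Moyal bracket expression satisfies: Σ_{(k,ℓ)} a_{kℓ} x^k p^ℓ g(q^ℓ x, q^{−k} p) − Σ_{(γ,β)} b_{γβ} x^γ p^β f(q^β x, q^{−γ} p) = Σ_{(k,ℓ)} Σ_{(γ,β)} a_{kℓ} b_{γβ} (q^{ℓγ − kβ} − q^{kβ − ℓγ}) x^{k+γ} p^{ℓ+β} (Proposition 4.1, with the normalizing constant taken equal to 1). -/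
/-- Proposition 4.1 (with normalizing constant 1): the q-Moyal bracket
`{f,g}_M = f(x q^{-p∂_p}, p q^{x∂_x}) g - g(x q^{-p∂_p}, p q^{x∂_x}) f`
equals the double sum with twisting factors `q^{ℓγ-kβ} - q^{kβ-ℓγ}`. -/
theorem q_moyal_bracket_formula
    (K : Type*) [Field K] (q : K) (hq : q ≠ 0)
    (a b : (ℕ × ℕ) →₀ K) (f g : K → K → K)
    (hf : ∀ x p : K, f x p = ∑ kl ∈ a.support, a kl * x ^ kl.1 * p ^ kl.2)
    (hg : ∀ x p : K, g x p = ∑ gb ∈ b.support, b gb * x ^ gb.1 * p ^ gb.2)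
    (x p : K) :
    (∑ kl ∈ a.support, a kl * x ^ kl.1 * p ^ kl.2 *
        g (q ^ (kl.2 : ℤ) * x) (q ^ (-(kl.1 : ℤ)) * p)) -
    (∑ gb ∈ b.support, b gb * x ^ gb.1 * p ^ gb.2 *
        f (q ^ (gb.2 : ℤ) * x) (q ^ (-(gb.1 : ℤ)) * p)) =
    ∑ kl ∈ a.support, ∑ gb ∈ b.support,
        a kl * b gb *
          (q ^ ((kl.2 : ℤ) * (gb.1 : ℤ) - (kl.1 : ℤ) * (gb.2 : ℤ)) -
            q ^ ((kl.1 : ℤ) * (gb.2 : ℤ) - (kl.2 : ℤ) * (gb.1 : ℤ))) *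
          x ^ (kl.1 + gb.1) * p ^ (kl.2 + gb.2) := by
  have key : ∀ m n r s : ℕ, q ^ ((m : ℤ) * (n : ℤ) - (r : ℤ) * (s : ℤ)) =
      (q ^ (m : ℤ)) ^ n * (q ^ (-(r : ℤ))) ^ s := by
    intro m n r s
    rw [← zpow_natCast (q ^ (m : ℤ)) n, ← zpow_natCast (q ^ (-(r : ℤ))) s, ← zpow_mul,
      ← zpow_mul, ← zpow_add₀ hq]
    congr 1
    ring
  simp only [hf, hg, Finset.mul_sum]
  rw [Finset.sum_comm (s := b.support), ← Finset.sum_sub_distrib]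
  refine Finset.sum_congr rfl fun kl _ => ?_
  rw [← Finset.sum_sub_distrib]
  refine Finset.sum_congr rfl fun gb _ => ?_
  rw [key, show (kl.1 : ℤ) * (gb.2 : ℤ) - (kl.2 : ℤ) * (gb.1 : ℤ) =
    (gb.2 : ℤ) * (kl.1 : ℤ) - (gb.1 : ℤ) * (kl.2 : ℤ) by ring, key]
  simp only [mul_pow, pow_add]
  generalize (q ^ (kl.2 : ℤ)) ^ gb.1 = A
  generalize (q ^ (-(kl.1 : ℤ))) ^ gb.2 = B
  generalize (q ^ (gb.2 : ℤ)) ^ kl.1 = C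
  generalize (q ^ (-(gb.1 : ℤ))) ^ kl.2 = D
  ring
end

section
/- Let κ be a nonzero real number and define, for real polynomial functions f, g of (x,p), the Moyal bracket {f,g}_κ = (f ∗_κ g − g ∗_κ f)/(2κ), where f ∗_κ g = Σ_{n=0}^∞ (κ^n/n!) Σ_{j=0}^n (−1)^j C(n,j) (∂_x^j ∂_p^{n−j} f)(∂_x^{n−j} ∂_p^j g). Then the Moyal bracket satisfies the Jacobi identity: for all polynomials f, g, h, {f, {g,h}_κ}_κ − {g, {f,h}_κ}_κ = {{f,g}_κ, h}_κ (equation (X240)). -/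
open MvPolynomial

/-- `∂_x` on polynomials in the two variables `x, p`. -/
noncomputable def dx : MvPolynomial (Fin 2) ℝ → MvPolynomial (Fin 2) ℝ :=
  fun h => pderiv (0 : Fin 2) h

/-- `∂_p` on polynomials in the two variables `x, p`. -/
noncomputable def dp : MvPolynomial (Fin 2) ℝ → MvPolynomial (Fin 2) ℝ :=
  fun h => pderiv (1 : Fin 2) h

/-- The Moyal star product with deformation parameter `κ`. -/
noncomputable def moyalStar (κ : ℝ) (f g : MvPolynomial (Fin 2) ℝ) :
    MvPolynomial (Fin 2) ℝ :=
  ∑ᶠ n : ℕ, (κ ^ n / (Nat.factorial n : ℝ)) •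
    ∑ j ∈ Finset.range (n + 1),
      ((-1 : ℝ) ^ j * (n.choose j : ℝ)) •
        (dx^[j] (dp^[n - j] f) * dx^[n - j] (dp^[j] g))

/-- The Moyal bracket `{f,g}_κ = (f ∗_κ g - g ∗_κ f)/(2κ)`. -/
noncomputable def moyalBracket (κ : ℝ) (f g : MvPolynomial (Fin 2) ℝ) :
    MvPolynomial (Fin 2) ℝ :=
  (2 * κ)⁻¹ • (moyalStar κ f g - moyalStar κ g f)

/-- The `n`-th bidifferential operator, recursively. -/
noncomputable def TT : ℕ → (MvPolynomial (Fin 2) ℝ →ₗ[ℝ] MvPolynomial (Fin 2) ℝ →ₗ[ℝ] MvPolynomial (Fin 2) ℝ)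
  | 0 => LinearMap.mul ℝ (MvPolynomial (Fin 2) ℝ)
  | n + 1 => (TT n).compl₁₂ (pderiv (1 : Fin 2)).toLinearMap (pderiv (0 : Fin 2)).toLinearMap
      - (TT n).compl₁₂ (pderiv (0 : Fin 2)).toLinearMap (pderiv (1 : Fin 2)).toLinearMap

theorem TT_zero (f g : MvPolynomial (Fin 2) ℝ) : TT 0 f g = f * g := rfl

theorem TT_succ (n : ℕ) (f g : MvPolynomial (Fin 2) ℝ) :
    TT (n + 1) f g = TT n (pderiv 1 f) (pderiv 0 g) - TT n (pderiv 0 f) (pderiv 1 g) := rfl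

theorem pd_comm (i j : Fin 2) (f : MvPolynomial (Fin 2) ℝ) :
    pderiv i (pderiv j f) = pderiv j (pderiv i f) := by
  have h : ⁅(pderiv i : Derivation ℝ (MvPolynomial (Fin 2) ℝ) (MvPolynomial (Fin 2) ℝ)), (pderiv j : Derivation ℝ (MvPolynomial (Fin 2) ℝ) (MvPolynomial (Fin 2) ℝ))⁆ = 0 := by
    apply MvPolynomial.derivation_ext
    intro k
    simp [Derivation.commutator_apply, pderiv_X, Pi.single_apply]
    split_ifs <;> simp
  have := congrArg (fun D => D f) h
  simpa [Derivation.commutator_apply, sub_eq_zero] using this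

theorem TT_leib (i : Fin 2) (n : ℕ) (f g : MvPolynomial (Fin 2) ℝ) :
    pderiv i (TT n f g) = TT n (pderiv i f) g + TT n f (pderiv i g) := by
  induction n generalizing f g with
  | zero => simp [TT_zero, Derivation.leibniz]; ring
  | succ n ih =>
    simp only [TT_succ, map_sub, ih]
    rw [pd_comm i 1 f, pd_comm i 0 f, pd_comm i 0 g, pd_comm i 1 g]
    abel

theorem TT_X0 (n : ℕ) (f g : MvPolynomial (Fin 2) ℝ) :
    TT n (X 0 * f) g = X 0 * TT n f g - (n : ℝ) • TT (n - 1) f (pderiv 1 g) := by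
  induction n generalizing f g with
  | zero => simp [TT_zero]; ring
  | succ n ih =>
    have h1 : pderiv 1 (X 0 * f) = X 0 * pderiv (1 : Fin 2) f := by
      simp [Derivation.leibniz, pderiv_X]
    have h0 : pderiv 0 (X 0 * f) = X 0 * pderiv (0 : Fin 2) f + f := by
      simp [Derivation.leibniz, pderiv_X]
    rw [TT_succ, h1, h0, map_add, LinearMap.add_apply, ih, ih, TT_succ]
    rcases n with _ | n
    · simp; ring
    · simp only [Nat.add_sub_cancel]
      rw [TT_succ n f (pderiv 1 g), pd_comm 0 1 g]
      simp only [smul_eq_C_mul]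
      push_cast
      simp only [map_add, map_one]
      ring

theorem TT_X1 (n : ℕ) (f g : MvPolynomial (Fin 2) ℝ) :
    TT n (X 1 * f) g = X 1 * TT n f g + (n : ℝ) • TT (n - 1) f (pderiv 0 g) := by
  induction n generalizing f g with
  | zero => simp [TT_zero]; ring
  | succ n ih =>
    have h1 : pderiv 0 (X 1 * f) = X 1 * pderiv (0 : Fin 2) f := by
      simp [Derivation.leibniz, pderiv_X]
    have h0 : pderiv 1 (X 1 * f) = X 1 * pderiv (1 : Fin 2) f + f := by
      simp [Derivation.leibniz, pderiv_X]
    rw [TT_succ, h1, h0, map_add, LinearMap.add_apply, ih, ih, TT_succ]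
    rcases n with _ | n
    · simp; ring
    · simp only [Nat.add_sub_cancel]
      rw [TT_succ n f (pderiv 0 g), pd_comm 1 0 g]
      simp only [smul_eq_C_mul]
      push_cast
      simp only [map_add, map_one]
      ring

theorem TT_C (n : ℕ) (a : ℝ) (g : MvPolynomial (Fin 2) ℝ) : TT (n + 1) (C a) g = 0 := by
  simp [TT_succ]

theorem TT_bound (f : MvPolynomial (Fin 2) ℝ) : ∃ N : ℕ, ∀ g, ∀ n ≥ N, TT n f g = 0 := by
  induction f using MvPolynomial.induction_on with
  | C a =>
    refine ⟨1, fun g n hn => ?_⟩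
    obtain ⟨m, rfl⟩ : ∃ m, n = m + 1 := ⟨n - 1, by omega⟩
    exact TT_C m a g
  | add p q hp hq =>
    obtain ⟨N, hN⟩ := hp
    obtain ⟨M, hM⟩ := hq
    refine ⟨max N M, fun g n hn => ?_⟩
    rw [map_add, LinearMap.add_apply, hN g n (le_trans (le_max_left _ _) hn),
      hM g n (le_trans (le_max_right _ _) hn), add_zero]
  | mul_X p i hp =>
    obtain ⟨N, hN⟩ := hp
    refine ⟨N + 1, fun g n hn => ?_⟩
    rw [mul_comm]
    fin_cases i
    · have := TT_X0 n p g
      rw [hN g n (by omega), hN _ (n - 1) (by omega)] at this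
      simpa using this
    · have := TT_X1 n p g
      rw [hN g n (by omega), hN _ (n - 1) (by omega)] at this
      simpa using this

theorem dx_iter_comm (j : ℕ) (f : MvPolynomial (Fin 2) ℝ) : dx^[j] (dp f) = dp (dx^[j] f) :=
  (Function.Commute.iterate_left (f := dx) (g := dp) (fun f => pd_comm 0 1 f) j) f

theorem TT_anti (n : ℕ) (f g : MvPolynomial (Fin 2) ℝ) :
    TT n f g = ∑ ij ∈ Finset.HasAntidiagonal.antidiagonal n, (n.choose ij.1 : MvPolynomial (Fin 2) ℝ) *
      ((-1) ^ ij.1 * (dx^[ij.1] (dp^[ij.2] f) * dx^[ij.2] (dp^[ij.1] g))) := by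
  induction n generalizing f g with
  | zero => simp [TT_zero]
  | succ n ih =>
    rw [Finset.sum_antidiagonal_choose_succ_mul
      (fun i j => (-1) ^ i * (dx^[i] (dp^[j] f) * dx^[j] (dp^[i] g))), TT_succ, ih, ih,
      sub_eq_add_neg, ← Finset.sum_neg_distrib]
    have hc : ∀ (j : ℕ) (f : MvPolynomial (Fin 2) ℝ), dp^[j] (dx f) = dx (dp^[j] f) := fun j =>
      (Function.Commute.iterate_left (f := dp) (g := dx) (fun f => pd_comm 1 0 f) j)
    refine congrArg₂ (fun a b => a + b) ?_ ?_
    · refine Finset.sum_congr rfl fun ij _ => ?_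
      rw [Function.iterate_succ_apply, Function.iterate_succ_apply, ← hc]
      rfl
    · refine Finset.sum_congr rfl fun ij hij => ?_
      rw [Function.iterate_succ_apply, Function.iterate_succ_apply, ← hc]
      have : n.choose ij.1 = n.choose ij.2 := by
        rw [Finset.HasAntidiagonal.mem_antidiagonal] at hij
        exact Nat.choose_symm_of_eq_add (by omega)
      rw [this, pow_succ]
      change _ = (n.choose ij.2 : MvPolynomial (Fin 2) ℝ) * ((-1) ^ ij.1 * -1 *
        (dx^[ij.1] (dp^[ij.2] (pderiv 0 f)) * dx^[ij.2] (dp^[ij.1] (pderiv 1 g))))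
      ring

theorem TT_eq (n : ℕ) (f g : MvPolynomial (Fin 2) ℝ) :
    ∑ j ∈ Finset.range (n + 1), ((-1 : ℝ) ^ j * (n.choose j : ℝ)) •
        (dx^[j] (dp^[n - j] f) * dx^[n - j] (dp^[j] g)) = TT n f g := by
  rw [TT_anti, Finset.Nat.sum_antidiagonal_eq_sum_range_succ_mk]
  refine Finset.sum_congr rfl fun j _ => ?_
  rw [smul_eq_C_mul]
  simp only [map_mul, map_pow, map_neg, map_one, map_natCast]
  ring

theorem star_bound (κ : ℝ) (f : MvPolynomial (Fin 2) ℝ) : ∃ N : ℕ, ∀ g, ∀ M ≥ N,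
    (moyalStar κ f g = ∑ n ∈ Finset.range M, (κ ^ n / (Nat.factorial n : ℝ)) • TT n f g) ∧
      TT M f g = 0 := by
  obtain ⟨N, hN⟩ := TT_bound f
  refine ⟨N, fun g M hM => ⟨?_, hN g M hM⟩⟩
  unfold moyalStar
  simp only [TT_eq]
  apply finsum_eq_sum_of_support_subset
  intro n hn
  simp only [Finset.coe_range, Set.mem_Iio]
  by_contra hlt
  exact hn (by simp [hN g n (by omega)])

theorem star_add_left (κ : ℝ) (f f' g : MvPolynomial (Fin 2) ℝ) :
    moyalStar κ (f + f') g = moyalStar κ f g + moyalStar κ f' g := by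
  obtain ⟨N, hN⟩ := star_bound κ f
  obtain ⟨N', hN'⟩ := star_bound κ f'
  obtain ⟨K, hK⟩ := star_bound κ (f + f')
  rw [(hN g (N + N' + K) (by omega)).1, (hN' g (N + N' + K) (by omega)).1,
    (hK g (N + N' + K) (by omega)).1, ← Finset.sum_add_distrib]
  simp

theorem star_smul_left (κ a : ℝ) (f g : MvPolynomial (Fin 2) ℝ) :
    moyalStar κ (a • f) g = a • moyalStar κ f g := by
  obtain ⟨N, hN⟩ := star_bound κ f
  obtain ⟨K, hK⟩ := star_bound κ (a • f)
  rw [(hN g (N + K) (by omega)).1, (hK g (N + K) (by omega)).1, Finset.smul_sum]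
  refine Finset.sum_congr rfl fun n _ => ?_
  rw [map_smul, LinearMap.smul_apply, smul_comm]

theorem star_add_right (κ : ℝ) (f g g' : MvPolynomial (Fin 2) ℝ) :
    moyalStar κ f (g + g') = moyalStar κ f g + moyalStar κ f g' := by
  obtain ⟨N, hN⟩ := star_bound κ f
  rw [(hN _ N le_rfl).1, (hN _ N le_rfl).1, (hN _ N le_rfl).1, ← Finset.sum_add_distrib]
  simp

theorem star_smul_right (κ a : ℝ) (f g : MvPolynomial (Fin 2) ℝ) :
    moyalStar κ f (a • g) = a • moyalStar κ f g := by
  obtain ⟨N, hN⟩ := star_bound κ f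
  rw [(hN _ N le_rfl).1, (hN _ N le_rfl).1, Finset.smul_sum]
  refine Finset.sum_congr rfl fun n _ => ?_
  rw [map_smul, smul_comm]

theorem star_sub_left (κ : ℝ) (f f' g : MvPolynomial (Fin 2) ℝ) :
    moyalStar κ (f - f') g = moyalStar κ f g - moyalStar κ f' g := by
  rw [eq_sub_iff_add_eq, ← star_add_left, sub_add_cancel]

theorem star_sub_right (κ : ℝ) (f g g' : MvPolynomial (Fin 2) ℝ) :
    moyalStar κ f (g - g') = moyalStar κ f g - moyalStar κ f g' := by
  rw [eq_sub_iff_add_eq, ← star_add_right, sub_add_cancel]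

theorem star_leib (κ : ℝ) (i : Fin 2) (f g : MvPolynomial (Fin 2) ℝ) :
    pderiv i (moyalStar κ f g) = moyalStar κ (pderiv i f) g + moyalStar κ f (pderiv i g) := by
  obtain ⟨N, hN⟩ := star_bound κ f
  obtain ⟨K, hK⟩ := star_bound κ (pderiv i f)
  rw [(hN _ (N + K) (by omega)).1, (hN _ (N + K) (by omega)).1, (hK _ (N + K) (by omega)).1,
    ← Finset.sum_add_distrib, map_sum]
  refine Finset.sum_congr rfl fun n _ => ?_
  rw [Derivation.map_smul, TT_leib, smul_add]

theorem star_C (κ a : ℝ) (g : MvPolynomial (Fin 2) ℝ) : moyalStar κ (C a) g = a • g := by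
  obtain ⟨N, hN⟩ := star_bound κ (C a)
  rw [(hN _ (N + 1) (by omega)).1, Finset.sum_range_succ']
  simp [TT_C, TT_zero, smul_eq_C_mul]

theorem sum_shift (κ : ℝ) (N : ℕ) (f g : MvPolynomial (Fin 2) ℝ) :
    ∑ n ∈ Finset.range (N + 1), (κ ^ n / (Nat.factorial n : ℝ)) • ((n : ℝ) • TT (n - 1) f g)
      = κ • ∑ n ∈ Finset.range N, (κ ^ n / (Nat.factorial n : ℝ)) • TT n f g := by
  rw [Finset.sum_range_succ', Finset.smul_sum]
  simp only [Nat.cast_zero, zero_smul, smul_zero, add_zero, Nat.add_sub_cancel]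
  refine Finset.sum_congr rfl fun n _ => ?_
  rw [smul_smul, smul_smul, Nat.factorial_succ]
  congr 1
  have : (Nat.factorial n : ℝ) ≠ 0 := by positivity
  have : ((n : ℝ) + 1) ≠ 0 := by positivity
  push_cast
  field_simp
  ring

theorem star_X0 (κ : ℝ) (f g : MvPolynomial (Fin 2) ℝ) :
    moyalStar κ (X 0 * f) g = X 0 * moyalStar κ f g - κ • moyalStar κ f (pderiv 1 g) := by
  obtain ⟨N, hN⟩ := star_bound κ f
  obtain ⟨K, hK⟩ := star_bound κ (X 0 * f)
  rw [(hN g (N + K + 1) (by omega)).1, (hN (pderiv 1 g) (N + K) (by omega)).1,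
    (hK _ (N + K + 1) (by omega)).1, ← sum_shift, Finset.mul_sum, ← Finset.sum_sub_distrib]
  refine Finset.sum_congr rfl fun n _ => ?_
  rw [TT_X0, smul_sub, mul_smul_comm]

theorem star_X1 (κ : ℝ) (f g : MvPolynomial (Fin 2) ℝ) :
    moyalStar κ (X 1 * f) g = X 1 * moyalStar κ f g + κ • moyalStar κ f (pderiv 0 g) := by
  obtain ⟨N, hN⟩ := star_bound κ f
  obtain ⟨K, hK⟩ := star_bound κ (X 1 * f)
  rw [(hN g (N + K + 1) (by omega)).1, (hN (pderiv 0 g) (N + K) (by omega)).1,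
    (hK _ (N + K + 1) (by omega)).1, ← sum_shift, Finset.mul_sum, ← Finset.sum_add_distrib]
  refine Finset.sum_congr rfl fun n _ => ?_
  rw [TT_X1, smul_add, mul_smul_comm]

theorem star_assoc (κ : ℝ) (f g h : MvPolynomial (Fin 2) ℝ) :
    moyalStar κ (moyalStar κ f g) h = moyalStar κ f (moyalStar κ g h) := by
  induction f using MvPolynomial.induction_on generalizing g h with
  | C a => rw [star_C, star_C, star_smul_left]
  | add p q hp hq => simp only [star_add_left, hp, hq]
  | mul_X p i hp =>
    rw [mul_comm]
    fin_cases i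
    · change moyalStar κ (moyalStar κ (X 0 * p) g) h = moyalStar κ (X 0 * p) (moyalStar κ g h)
      simp only [star_X0, star_sub_left, star_smul_left, star_leib, star_add_right, hp, smul_add]
      abel
    · change moyalStar κ (moyalStar κ (X 1 * p) g) h = moyalStar κ (X 1 * p) (moyalStar κ g h)
      simp only [star_X1, star_add_left, star_smul_left, star_leib, star_add_right, hp, smul_add]
      abel

/-- Equation (X240): the Moyal bracket satisfies the Jacobi identity. -/
theorem moyal_bracket_jacobi
    (κ : ℝ) (hκ : κ ≠ 0) (f g h : MvPolynomial (Fin 2) ℝ) :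
    moyalBracket κ f (moyalBracket κ g h) - moyalBracket κ g (moyalBracket κ f h) =
      moyalBracket κ (moyalBracket κ f g) h := by
  simp only [moyalBracket, star_smul_left, star_smul_right, star_sub_left, star_sub_right,
    star_assoc, ← smul_sub]
  congr 2
  abel
end
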